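/- Let K be a field of characteristic ≠ 2 with more than three elements, G = SL₂(K), and V a quadratic ℤ[G]-module. Let w = (0 1; −1 0) and, for λ ∈ K×, t_λ = (λ 0; 0 λ⁻¹). Then for every λ ∈ K× and every v ∈ [U,V]: u_λ·(w·v) − w·v = −(t_λ·v). -/

import Mathlib

/-!
STATEMENT 6: Let K be a field of characteristic ≠ 2 with more than three elements,
G = SL₂(K), and V a quadratic ℤ[G]-module.  Let w = (0 1; −1 0) and, for λ ∈ K×,
t_λ = (λ 0; 0 λ⁻¹).  Then for every λ ∈ K× and every v ∈ [U,V]: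
u_λ·(w·v) − w·v = −(t_λ·v).
-/

noncomputable section

abbrev SL2 (K : Type*) [Field K] := Matrix.SpecialLinearGroup (Fin 2) K

/-- `u_λ = (1 λ; 0 1)`. -/
def uEl {K : Type*} [Field K] (lam : K) : SL2 K :=
  ⟨!![1, lam; 0, 1], by simp [Matrix.det_fin_two_of]⟩

/-- `w = (0 1; −1 0)`. -/
def wEl (K : Type*) [Field K] : SL2 K :=
  ⟨!![0, 1; -1, 0], by simp [Matrix.det_fin_two_of]⟩

/-- `t_λ = (λ 0; 0 λ⁻¹)` for `λ ≠ 0`. -/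
def tEl {K : Type*} [Field K] (lam : K) (h : lam ≠ 0) : SL2 K :=
  ⟨!![lam, 0; 0, lam⁻¹], by simp [Matrix.det_fin_two_of, mul_inv_cancel₀ h]⟩

/-- `[S,V]`, the subgroup of `V` generated by `{g·v − v : g ∈ S, v ∈ V}`. -/
def commV {K : Type*} (V : Type*) [Field K] [AddCommGroup V] [DistribMulAction (SL2 K) V]
    (S : Set (SL2 K)) : AddSubgroup V :=
  AddSubgroup.closure {w | ∃ g ∈ S, ∃ v : V, w = g • v - v}

set_option linter.unusedSimpArgs false

theorem coe_u {K : Type*} [Field K] (a : K) :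
    ((uEl a : SL2 K) : Matrix (Fin 2) (Fin 2) K) = !![1, a; 0, 1] := rfl
theorem coe_w {K : Type*} [Field K] :
    ((wEl K : SL2 K) : Matrix (Fin 2) (Fin 2) K) = !![0, 1; -1, 0] := rfl
theorem coe_t {K : Type*} [Field K] (a : K) (h : a ≠ 0) :
    ((tEl a h : SL2 K) : Matrix (Fin 2) (Fin 2) K) = !![a, 0; 0, a⁻¹] := rfl

theorem uEl_add {K : Type*} [Field K] (a b : K) : uEl (a + b) = uEl a * uEl b := by
  ext i j
  fin_cases i <;> fin_cases j <;>
    simp [coe_u, coe_w, coe_t, Matrix.SpecialLinearGroup.coe_mul, Matrix.SpecialLinearGroup.coe_inv,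
      Matrix.mul_apply, Matrix.adjugate_fin_two, Fin.sum_univ_two, add_comm]

theorem uEl_zero {K : Type*} [Field K] : uEl (0 : K) = 1 := by
  ext i j
  fin_cases i <;> fin_cases j <;>
    simp [coe_u, coe_w, coe_t, Matrix.SpecialLinearGroup.coe_mul, Matrix.SpecialLinearGroup.coe_inv,
      Matrix.mul_apply, Matrix.adjugate_fin_two, Fin.sum_univ_two]

theorem rel_tu {K : Type*} [Field K] (m : K) (h : m ≠ 0) (a : K) :
    uEl (m ^ 2 * a) * tEl m h = tEl m h * uEl a := by
  ext i j
  fin_cases i <;> fin_cases j <;>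
    simp [coe_u, coe_w, coe_t, Matrix.SpecialLinearGroup.coe_mul, Matrix.SpecialLinearGroup.coe_inv,
      Matrix.mul_apply, Matrix.adjugate_fin_two, Fin.sum_univ_two]
  field_simp

theorem rel_tw {K : Type*} [Field K] (m : K) (h : m ≠ 0) :
    wEl K * (tEl m h)⁻¹ = tEl m h * wEl K := by
  ext i j
  fin_cases i <;> fin_cases j <;>
    simp [coe_u, coe_w, coe_t, Matrix.SpecialLinearGroup.coe_mul, Matrix.SpecialLinearGroup.coe_inv,
      Matrix.mul_apply, Matrix.adjugate_fin_two, Fin.sum_univ_two]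

theorem rel_main {K : Type*} [Field K] (m : K) (h : m ≠ 0) :
    uEl m * wEl K = tEl m h * (wEl K * (uEl (-m) * (wEl K * uEl (-m⁻¹)))) := by
  ext i j
  fin_cases i <;> fin_cases j <;>
    simp [coe_u, coe_w, coe_t, Matrix.SpecialLinearGroup.coe_mul, Matrix.SpecialLinearGroup.coe_inv,
      Matrix.mul_apply, Matrix.adjugate_fin_two, Fin.sum_univ_two, h]

theorem rel_br {K : Type*} [Field K] (m : K) (h : m ≠ 0) :
    tEl m h * wEl K = uEl m * ((wEl K)⁻¹ * (uEl m⁻¹ * (wEl K * uEl m))) := by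
  ext i j
  fin_cases i <;> fin_cases j <;>
    simp [coe_u, coe_w, coe_t, Matrix.SpecialLinearGroup.coe_mul, Matrix.SpecialLinearGroup.coe_inv,
      Matrix.mul_apply, Matrix.adjugate_fin_two, Fin.sum_univ_two, h]

theorem rel_z {K : Type*} [Field K] (h : (-1 : K) ≠ 0) (g : SL2 K) :
    tEl (-1) h * g = g * tEl (-1) h := by
  ext i j
  fin_cases i <;> fin_cases j <;>
    simp [coe_u, coe_w, coe_t, Matrix.SpecialLinearGroup.coe_mul, Matrix.SpecialLinearGroup.coe_inv,
      Matrix.mul_apply, Matrix.adjugate_fin_two, Fin.sum_univ_two]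

theorem rel_ww {K : Type*} [Field K] (h : (-1 : K) ≠ 0) :
    wEl K * wEl K = tEl (-1) h := by
  ext i j
  fin_cases i <;> fin_cases j <;>
    simp [coe_u, coe_w, coe_t, Matrix.SpecialLinearGroup.coe_mul, Matrix.SpecialLinearGroup.coe_inv,
      Matrix.mul_apply, Matrix.adjugate_fin_two, Fin.sum_univ_two]

theorem rel_one {K : Type*} [Field K] (h : (1 : K) ≠ 0) : tEl (1 : K) h = 1 := by
  ext i j
  fin_cases i <;> fin_cases j <;>
    simp [coe_u, coe_w, coe_t, Matrix.SpecialLinearGroup.coe_mul, Matrix.SpecialLinearGroup.coe_inv,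
      Matrix.mul_apply, Matrix.adjugate_fin_two, Fin.sum_univ_two]

set_option linter.unusedVariables false
/-- points fixed by the generators -/
def fixN (K V : Type*) [Field K] [AddCommGroup V] [DistribMulAction (SL2 K) V] :
    AddSubgroup V where
  carrier := {m | (∀ a : K, uEl a • m = m) ∧ wEl K • m = m ∧
    ∀ (a : K) (h : a ≠ 0), tEl a h • m = m}
  zero_mem' := by simp
  add_mem' := by
    rintro a b ⟨h1, h2, h3⟩ ⟨k1, k2, k3⟩
    refine ⟨fun c => ?_, ?_, fun c h => ?_⟩
    · rw [smul_add, h1, k1]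
    · rw [smul_add, h2, k2]
    · rw [smul_add, h3, k3]
  neg_mem' := by
    rintro a ⟨h1, h2, h3⟩
    refine ⟨fun c => ?_, ?_, fun c h => ?_⟩
    · rw [smul_neg, h1]
    · rw [smul_neg, h2]
    · rw [smul_neg, h3]

theorem gen_lem {K V : Type*} [Field K] [AddCommGroup V] [DistribMulAction (SL2 K) V]
    (N : AddSubgroup V) (hN : N ≤ fixN K V) (b : V)
    (h1 : ∀ a : K, uEl a • b - b ∈ N) (h2 : ∀ a : K, uEl a • (wEl K • b) - wEl K • b ∈ N) :
    wEl K • b - b ∈ N ∧ ∀ (a : K) (h : a ≠ 0), tEl a h • b - b ∈ N := by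
  have key : ∀ (a : K) (h : a ≠ 0), tEl a h • wEl K • b - b ∈ N := by
    intro a h
    have e1 := h1 a
    have e2 := h2 a⁻¹
    set n := uEl a • b - b with hn
    set n' := uEl a⁻¹ • (wEl K • b) - wEl K • b with hn'
    have hb : uEl a • b = b + n := by rw [hn]; abel
    have hb' : uEl a⁻¹ • wEl K • b = wEl K • b + n' := by rw [hn']; abel
    have w1 := (hN e1).2.1
    have w2 := (hN e2).2.1
    have w1' : (wEl K)⁻¹ • n = n := by rw [inv_smul_eq_iff, w1]
    have w2' : (wEl K)⁻¹ • n' = n' := by rw [inv_smul_eq_iff, w2]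
    have : tEl a h • wEl K • b = b + n + n' + n := by
      rw [← mul_smul, rel_br, mul_smul, mul_smul, mul_smul, mul_smul, hb, smul_add, w1, smul_add,
        hb', (hN e1).1, smul_add, smul_add, smul_add, inv_smul_smul, w1', w2', smul_add, hb,
        (hN e1).1, (hN e2).1]
    rw [this]
    have e : b + n + n' + n - b = n + n' + n := by abel
    rw [e]
    exact N.add_mem (N.add_mem e1 e2) e1
  have hw : wEl K • b - b ∈ N := by
    have := key 1 one_ne_zero
    rwa [rel_one, one_smul] at this
  refine ⟨hw, fun a h => ?_⟩
  have e := key a h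
  have e2 : tEl a h • wEl K • b = tEl a h • b + (wEl K • b - b) := by
    have := (hN hw).2.2 a h
    rw [smul_sub] at this
    rw [← this]; abel
  rw [e2] at e
  have e3 := N.sub_mem e hw
  convert e3 using 1
  abel

section
variable {K V : Type*} [Field K] [AddCommGroup V] [DistribMulAction (SL2 K) V]

theorem y_fix 
    (hquad : ∀ (lam mu : K) (v : V), uEl lam • (uEl mu • v - v) = uEl mu • v - v)
    (v : V) (hv : ∀ a : K, uEl a • v = v) (m : K) (h : m ≠ 0) :
    tEl m h • v + (uEl m • wEl K • v - wEl K • v) ∈ fixN K V := by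
  have hz : (-1 : K) ≠ 0 := by simp
  have utf : ∀ (x : V), (∀ a : K, uEl a • x = x) → ∀ (c : K) (hc : c ≠ 0) (a : K),
      uEl a • tEl c hc • x = tEl c hc • x := by
    intro x hx c hc a
    have e : a = c ^ 2 * (a / c ^ 2) := by field_simp
    rw [e, ← mul_smul, rel_tu, mul_smul, hx]
  have hd : ∀ a : K, uEl a • (uEl m • wEl K • v - wEl K • v) = uEl m • wEl K • v - wEl K • v :=
    fun a => hquad a m _
  set d := uEl m • wEl K • v - wEl K • v with hdd
  have hux : uEl m • wEl K • v = wEl K • v + d := by rw [hdd]; abel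
  have hnx : uEl (-m) • wEl K • v = wEl K • v - d := by
    have h1 := hd (-m)
    have h2 : uEl (-m) • uEl m • wEl K • v = wEl K • v := by
      rw [← mul_smul, ← uEl_add, neg_add_cancel, uEl_zero, one_smul]
    rw [hux, smul_add, h1] at h2
    exact eq_sub_of_add_eq h2
  have hrel : wEl K • v + d = tEl m h • wEl K • wEl K • v - tEl m h • wEl K • d := by
    rw [← hux, ← mul_smul, rel_main m h]
    simp only [mul_smul]
    rw [hv, hnx, smul_sub, smul_sub]
  have hty : (tEl m h)⁻¹ • (tEl m h • v + d) = v + (tEl m h)⁻¹ • d := by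
    rw [smul_add, inv_smul_smul]
  have hwm : wEl K • (v + (tEl m h)⁻¹ • d) = tEl m h • wEl K • wEl K • v - d := by
    rw [smul_add, ← mul_smul, rel_tw, mul_smul, eq_sub_iff_add_eq, add_right_comm, hrel]; abel
  have hy : ∀ a : K, uEl a • (tEl m h • v + d) = tEl m h • v + d := by
    intro a
    rw [smul_add, utf v hv, hd]
  set y := tEl m h • v + d with hyd
  rw [← hty] at hwm
  have hm1 : ∀ a : K, uEl a • (tEl m h)⁻¹ • y = (tEl m h)⁻¹ • y := by
    intro a
    rw [eq_inv_smul_iff, ← mul_smul, ← rel_tu, mul_smul, smul_inv_smul, hy]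
  have hm2 : ∀ a : K, uEl a • wEl K • (tEl m h)⁻¹ • y = wEl K • (tEl m h)⁻¹ • y := by
    intro a
    rw [hwm, smul_sub, hd, ← mul_smul (wEl K), rel_ww hz, utf _ (utf v hv _ _)]
  obtain ⟨g1, g2⟩ := gen_lem (⊥ : AddSubgroup V) bot_le ((tEl m h)⁻¹ • y)
    (fun a => by rw [hm1, sub_self]; exact zero_mem _)
    (fun a => by rw [hm2, sub_self]; exact zero_mem _)
  have hmem : (tEl m h)⁻¹ • y ∈ fixN K V :=
    ⟨hm1, sub_eq_zero.mp g1, fun a ha => sub_eq_zero.mp (g2 a ha)⟩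
  have := hmem.2.2 m h
  rw [smul_inv_smul] at this
  rwa [← this] at hmem

theorem add_z_fix
    (hquad : ∀ (lam mu : K) (v : V), uEl lam • (uEl mu • v - v) = uEl mu • v - v)
    (v : V) (hv : ∀ a : K, uEl a • v = v) (hz : (-1 : K) ≠ 0) :
    v + tEl (-1) hz • v ∈ fixN K V := by
  have h1 := y_fix hquad v hv 1 one_ne_zero
  have h2 := y_fix hquad v hv (-1) hz
  have h3 := hquad (-1) 1 (wEl K • v)
  rw [smul_sub, ← mul_smul, ← uEl_add, neg_add_cancel, uEl_zero, one_smul] at h3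
  rw [← h3, rel_one, one_smul] at h1
  convert add_mem h1 h2 using 1
  abel

theorem add_z_zero (hcard : 3 < Cardinal.mk K)
    (hquad : ∀ (lam mu : K) (v : V), uEl lam • (uEl mu • v - v) = uEl mu • v - v)
    (a : V) (hz : (-1 : K) ≠ 0) (l : K) :
    tEl (-1) hz • (uEl l • a - a) = -(uEl l • a - a) := by
  obtain ⟨c, c0, c1⟩ : ∃ c : K, c ≠ 0 ∧ c ^ 2 - 1 ≠ 0 := by
    classical
    by_contra! hcon
    have hs : (Set.univ : Set K) ⊆ (({0, 1, -1} : Finset K) : Set K) := by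
      intro c _
      by_cases h0 : c = 0
      · simp [h0]
      · have := hcon c h0
        have h2 : (c - 1) * (c + 1) = 0 := by linear_combination this
        rcases mul_eq_zero.mp h2 with h | h
        · simp [sub_eq_zero.mp h]
        · simp [eq_neg_of_add_eq_zero_left h]
    have h3 := Cardinal.mk_le_mk_of_subset hs
    rw [Cardinal.mk_univ] at h3
    replace h3 := h3.trans_eq (Cardinal.mk_coe_finset (s := ({0, 1, -1} : Finset K)))
    have h4 : ({0, 1, -1} : Finset K).card ≤ 3 := Finset.card_le_three
    have h5 : (({0, 1, -1} : Finset K).card : Cardinal) ≤ 3 := by exact_mod_cast h4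
    exact absurd hcard (not_lt.mpr (h3.trans h5))
  have hb : ∀ (x : V) (r : K), uEl r • (x + tEl (-1) hz • x) - (x + tEl (-1) hz • x) =
      (uEl r • x - x) + tEl (-1) hz • (uEl r • x - x) := by
    intro x r
    rw [smul_add, smul_sub, ← mul_smul, ← rel_z, mul_smul]
    abel
  have hf : ∀ (x : V) (r : K), uEl r • (x + tEl (-1) hz • x) - (x + tEl (-1) hz • x) ∈ fixN K V := by
    intro x r
    rw [hb]
    exact add_z_fix hquad _ (fun s => hquad s r x) hz
  have hwb : wEl K • (a + tEl (-1) hz • a) = wEl K • a + tEl (-1) hz • wEl K • a := by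
    rw [smul_add, ← mul_smul, ← rel_z, mul_smul]
  obtain ⟨-, g⟩ := gen_lem (fixN K V) le_rfl (a + tEl (-1) hz • a) (hf a)
    (fun r => by rw [hwb]; exact hf _ r)
  have hfa := hf a
  have hba := hb a l
  set b := a + tEl (-1) hz • a with hbd
  have hall : ∀ r : K, uEl ((c ^ 2 - 1) * r) • b = b := by
    intro r
    have e1 := (hfa r).2.2 c c0
    have e2 := (g c c0).1 (c ^ 2 * r)
    rw [smul_sub, ← mul_smul, ← rel_tu, mul_smul] at e1
    rw [smul_sub] at e2
    have e3 : uEl (c ^ 2 * r) • b = uEl r • b := by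
      have : uEl (c ^ 2 * r) • b - uEl r • b =
        (uEl (c ^ 2 * r) • tEl c c0 • b - tEl c c0 • b - (uEl r • b - b)) -
        ((uEl (c ^ 2 * r) • tEl c c0 • b - uEl (c ^ 2 * r) • b) - (tEl c c0 • b - b)) := by abel
      rw [e1, e2, sub_self, sub_self, sub_self] at this
      exact sub_eq_zero.mp this
    have e4 : (c ^ 2 - 1) * r = -r + c ^ 2 * r := by ring
    rw [e4, uEl_add, mul_smul, e3, ← mul_smul, ← uEl_add, neg_add_cancel, uEl_zero, one_smul]
  have := hall ((c ^ 2 - 1)⁻¹ * l)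
  rw [mul_inv_cancel_left₀ c1] at this
  rw [this, sub_self] at hba
  exact eq_neg_of_add_eq_zero_right hba.symm

end

theorem stmt6 (K V : Type*) [Field K]
    (hchar : ringChar K ≠ 2) (hcard : 3 < Cardinal.mk K)
    [AddCommGroup V] [DistribMulAction (SL2 K) V]
    (hquad : ∀ (lam mu : K) (v : V), uEl lam • (uEl mu • v - v) = uEl mu • v - v) :
    ∀ (lam : K) (hlam : lam ≠ 0), ∀ v ∈ commV V (Set.range (uEl (K := K))),
      uEl lam • (wEl K • v) - wEl K • v = -(tEl lam hlam • v) := by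
  intro lam hlam v hv
  have h2 : (2 : K) ≠ 0 := Ring.two_ne_zero hchar
  haveI : NeZero (2 : K) := ⟨h2⟩
  have hz : (-1 : K) ≠ 0 := by simp
  unfold commV at hv
  induction hv using AddSubgroup.closure_induction with
  | mem x hx =>
    obtain ⟨g, ⟨l, rfl⟩, a, rfl⟩ := hx
    have hd : uEl l • a - a = (uEl (l / 2) • a - a) + (uEl (l / 2) • a - a) := by
      have e := hquad (l / 2) (l / 2) a
      rw [smul_sub, ← mul_smul, ← uEl_add, add_halves] at e
      rw [sub_eq_iff_eq_add] at e
      rw [e]; abel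
    have hzv := add_z_zero hcard hquad a hz (l / 2)
    have hu : ∀ s, uEl s • (uEl (l / 2) • a - a) = uEl (l / 2) • a - a :=
      fun s => hquad s _ a
    rw [hd]
    generalize uEl (l / 2) • a - a = v at *
    have hy := y_fix hquad v hu lam hlam
    have hzy := hy.2.2 (-1) hz
    have hneg : tEl (-1) hz • (tEl lam hlam • v + (uEl lam • wEl K • v - wEl K • v)) =
        -(tEl lam hlam • v + (uEl lam • wEl K • v - wEl K • v)) := by
      have c : ∀ g : SL2 K, tEl (-1) hz • g • v = -(g • v) := by
        intro g
        rw [← mul_smul, rel_z, mul_smul, hzv, smul_neg]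
      rw [smul_add, smul_sub, c, c, ← mul_smul (uEl lam), c]
      abel
    rw [hneg] at hzy
    rw [eq_neg_iff_add_eq_zero]
    simp only [smul_add]
    set y := tEl lam hlam • v + (uEl lam • wEl K • v - wEl K • v) with hyd
    have hyy : y + y = 0 := by
      nth_rewrite 1 [← hzy]
      exact neg_add_cancel y
    rw [← hyy, hyd]
    abel
  | zero => simp
  | add x y _ _ hx hy =>
    simp only [smul_add]
    rw [neg_add, ← hx, ← hy]; abel
  | neg x _ hx =>
    simp only [smul_neg]
    rw [← hx]; abel
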